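/- Fix θ = (σ,δ,α) with σ > 0, δ > 0, α ∈ (0,2). There exist C > 0 and N ∈ ℕ such that for all n ≥ N, all Γ ≥ 1 and all y with |y| > Γ: (i) |f_α(y, w_n(θ)) − φ(y) − c_α w_n(θ)^α ψ_α^{(0)}(y)| ≤ C f_α(y, w_n(θ)) (1/√Γ + 1/n^{1−α/2}); and (ii) |h_α(y, w_n(θ)) + α c_α w_n(θ)^α ψ_α^{(0)}(y)| ≤ C w_n(θ)^α ψ_α^{(0)}(y) (1/√Γ + 1/n^{1−α/2}). -/

import Mathlib

open MeasureTheory Filter Set Topology Matrix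

noncomputable section

namespace LevyLAN
/-- Standard Gaussian density `φ`. -/
def gauss (y : ℝ) : ℝ := (Real.sqrt (2 * Real.pi))⁻¹ * Real.exp (-(y ^ 2) / 2)

/-- Symmetric `α`-stable density `φ_α`, defined by Fourier inversion. -/
def stableDensity (α z : ℝ) : ℝ :=
  (2 * Real.pi)⁻¹ * ∫ u : ℝ, Real.cos (z * u) * Real.exp (-(|u| ^ α))

/-- `∂_α φ_α`. -/
def stableDensityDalpha (α z : ℝ) : ℝ :=
  -(2 * Real.pi)⁻¹ * ∫ u : ℝ, Real.cos (z * u) * |u| ^ α * Real.log |u| * Real.exp (-(|u| ^ α))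

/-- The operator `(D f) y = (y * f y)' = f y + y * f' y`. -/
def Dop (f : ℝ → ℝ) (y : ℝ) : ℝ := f y + y * deriv f y

/-- `f_α(y, w)`. -/
def fFun (α y w : ℝ) : ℝ := ∫ z : ℝ, gauss (y - w * z) * stableDensity α z

/-- `g_α(y, w)`. -/
def gFun (α y w : ℝ) : ℝ := ∫ z : ℝ, Dop gauss (y - w * z) * stableDensity α z

/-- `h_α(y, w)`. -/
def hFun (α y w : ℝ) : ℝ := ∫ z : ℝ, gauss (y - w * z) * Dop (stableDensity α) z

/-- `k_α(y, w)`. -/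
def kFun (α y w : ℝ) : ℝ := ∫ z : ℝ, gauss (y - w * z) * stableDensityDalpha α z

/-- `c_α`. -/
def cAlpha (α : ℝ) : ℝ :=
  if α = 1 then 1 / Real.pi
  else -(α * (α - 1)) / (2 * Real.Gamma (2 - α) * Real.cos (Real.pi * α / 2))

/-- `w_n(θ) = n^{1/2 - 1/α} δ / σ`. -/
def wn (n : ℕ) (σ δ α : ℝ) : ℝ := (n : ℝ) ^ ((1 : ℝ) / 2 - 1 / α) * δ / σ

/-- `l_α(y, w)` (it depends on `n`). -/
def lFun (n : ℕ) (α y w : ℝ) : ℝ :=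
  ((Real.log n - Real.log (Real.log n)) / (2 * α) - Real.log n / α ^ 2) * hFun α y w
    + kFun α y w

def kappa0 (σ δ α : ℝ) : ℝ := 2 * cAlpha α / (α * (2 - α) ^ (α / 2)) * (δ / σ) ^ α

def kappa1 (σ δ α : ℝ) : ℝ :=
  Real.log (δ / σ) + deriv cAlpha α / cAlpha α - Real.log (2 - α) / 2 - 1 / α

/-- The density `p_{1/n}(y, θ)`, with parameter `θ = (σ, δ, α) : Fin 3 → ℝ`. -/
def pdens (n : ℕ) (θ : Fin 3 → ℝ) (y : ℝ) : ℝ :=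
  Real.sqrt n / θ 0 * fFun (θ 2) (Real.sqrt n * y / θ 0) (wn n (θ 0) (θ 1) (θ 2))

/-- The log-likelihood `ln L_n(θ)`. -/
def logLik (n : ℕ) (θ : Fin 3 → ℝ) (x : Fin n → ℝ) : ℝ :=
  ∑ i, Real.log (pdens n θ (x i))

/-- Partial derivative in the `j`-th parameter coordinate. -/
def pderiv (j : Fin 3) (F : (Fin 3 → ℝ) → ℝ) (θ : Fin 3 → ℝ) : ℝ :=
  deriv (fun t => F (Function.update θ j t)) (θ j)

/-- The score `G_n(θ) = ∇_θ ln L_n(θ)`. -/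
def scoreVec (n : ℕ) (θ : Fin 3 → ℝ) (x : Fin n → ℝ) : Fin 3 → ℝ :=
  fun j => pderiv j (fun θ' => logLik n θ' x) θ

/-- The Hessian matrix `J_n(θ)` of the log-likelihood. -/
def hessMat (n : ℕ) (θ : Fin 3 → ℝ) (x : Fin n → ℝ) : Matrix (Fin 3) (Fin 3) ℝ :=
  Matrix.of fun i j => pderiv i (fun θ' => pderiv j (fun θ'' => logLik n θ'' x) θ') θ

def rate (n : ℕ) (α : ℝ) : ℝ := Real.log n ^ (α / 4) / (n : ℝ) ^ (α / 4)

/-- The rate matrix `u_n(θ)`. -/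
def un (n : ℕ) (θ : Fin 3 → ℝ) : Matrix (Fin 3) (Fin 3) ℝ :=
  !![1 / Real.sqrt n, 0, 0;
     0, rate n (θ 2), -(rate n (θ 2) * (θ 1 / (2 * θ 2)) * (Real.log n - Real.log (Real.log n)));
     0, 0, rate n (θ 2)]

/-- The information matrix `I(θ)`. -/
def Imat (θ : Fin 3 → ℝ) : Matrix (Fin 3) (Fin 3) ℝ :=
  !![2 / θ 0 ^ 2, 0, 0;
     0, θ 2 ^ 2 / θ 1 ^ 2 * kappa0 (θ 0) (θ 1) (θ 2),
        θ 2 / θ 1 * kappa0 (θ 0) (θ 1) (θ 2) * kappa1 (θ 0) (θ 1) (θ 2);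
     0, θ 2 / θ 1 * kappa0 (θ 0) (θ 1) (θ 2) * kappa1 (θ 0) (θ 1) (θ 2),
        kappa0 (θ 0) (θ 1) (θ 2) * (kappa1 (θ 0) (θ 1) (θ 2) ^ 2 + 1 / θ 2 ^ 2)]

/-- `ℙ_n`, the `n`-fold product of the law with Lebesgue density `p_{1/n}(·, θ)`. -/
def Pn (n : ℕ) (θ : Fin 3 → ℝ) : Measure (Fin n → ℝ) :=
  Measure.pi fun _ => MeasureTheory.volume.withDensity fun y => ENNReal.ofReal (pdens n θ y)

/-- The standard Gaussian measure on `ℝ³`. -/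
def stdGauss3 : Measure (Fin 3 → ℝ) :=
  Measure.pi fun _ => ProbabilityTheory.gaussianReal 0 1

/-- Euclidean (Frobenius) norm of a real 3×3 matrix. -/
def frobNorm (M : Matrix (Fin 3) (Fin 3) ℝ) : ℝ := Real.sqrt (∑ i, ∑ j, M i j ^ 2)

/-- Euclidean norm of a vector of `ℝ³`. -/
def vecNorm (v : Fin 3 → ℝ) : ℝ := Real.sqrt (∑ j, v j ^ 2)

/-- The admissible families of functions `ψ_α^{(p)}`. -/
structure IsPsiFamily (ψ : ℝ → ℕ → ℝ → ℝ) : Prop where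
  contDiff : ∀ α ∈ Set.Ioo (0 : ℝ) 2, ∀ p : ℕ, ContDiff ℝ 2 (ψ α p)
  pos : ∀ α ∈ Set.Ioo (0 : ℝ) 2, ∀ p : ℕ, ∀ y : ℝ, 0 < ψ α p y
  even : ∀ α ∈ Set.Ioo (0 : ℝ) 2, ∀ p : ℕ, ∀ y : ℝ, ψ α p (-y) = ψ α p y
  eq_one : ∀ α ∈ Set.Ioo (0 : ℝ) 2, ∀ p : ℕ, ∀ y : ℝ, |y| ≤ 1 → ψ α p y = 1
  eq_tail : ∀ α ∈ Set.Ioo (0 : ℝ) 2, ∀ p : ℕ, ∀ y : ℝ, 3 ≤ |y| →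
    ψ α p y = Real.log |y| ^ p / |y| ^ (α + 1)
  unifBound : ∀ K : Set ℝ, K ⊆ Set.Ioo (0 : ℝ) 2 → IsCompact K → ∀ p : ℕ,
    ∃ c > (0 : ℝ), ∃ C : ℝ, ∀ α ∈ K, ∀ y : ℝ, 1 ≤ |y| → |y| ≤ 3 →
      c ≤ ψ α p y ∧ ψ α p y ≤ C

/-- `𝓘_α^{(k,l)}`. -/
def Ical (ψ : ℝ → ℕ → ℝ → ℝ) (α : ℝ) (k l : ℕ) (y : ℝ) : ℝ :=
  ∫ z in {z : ℝ | 1 < |z|}, Dop^[k] gauss (y - z) * ψ α l z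

/-- `f_α^{(k,l,m)}`. -/
def fklm (α : ℝ) (k l m : ℕ) (y w : ℝ) : ℝ :=
  ∫ z : ℝ, Dop^[k] gauss (y - w * z)
    * Dop^[l] (fun z' => iteratedDeriv m (fun a => stableDensity a z') α) z

def Gamman (n : ℕ) (α : ℝ) : ℝ := Real.sqrt ((1 - α / 2) * Real.log n)

def Mn (n : ℕ) (α : ℝ) : ℝ := Real.sqrt ((2 - α) * Real.log n)

def Kconst (σ δ α : ℝ) : ℝ := deriv cAlpha α + cAlpha α * Real.log (δ / σ)

theorem cov_int {E : Type*} [NormedAddCommGroup E] [NormedSpace ℝ E] (g : ℝ → E) :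
    ∫ u in Ioi (0:ℝ), g u = ∫ s : ℝ, Real.exp s • g (Real.exp s) := by
  have h := integral_image_eq_integral_abs_deriv_smul (s := univ) (f := Real.exp) (f' := Real.exp)
    MeasurableSet.univ (fun x _ => (Real.hasDerivAt_exp x).hasDerivWithinAt)
    (Real.exp_injective.injOn) g
  simpa [Real.range_exp] using h

theorem cov_integrable {E : Type*} [NormedAddCommGroup E] [NormedSpace ℝ E] (g : ℝ → E) :
    IntegrableOn g (Ioi (0:ℝ)) ↔ Integrable (fun s : ℝ => Real.exp s • g (Real.exp s)) := by
  have h := integrableOn_image_iff_integrableOn_abs_deriv_smul (s := univ) (f := Real.exp)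
    (f' := Real.exp)
    MeasurableSet.univ (fun x _ => (Real.hasDerivAt_exp x).hasDerivWithinAt)
    (Real.exp_injective.injOn) g
  simpa [Real.range_exp] using h

theorem gam_integrable {a r : ℝ} (ha : 0 < a) (hr : 0 < r) :
    Integrable (fun s : ℝ => Real.exp (a * s - r * Real.exp s)) := by
  have h := (cov_integrable (fun u : ℝ => u ^ (a - 1) * Real.exp (-r * u ^ (1:ℝ)))).1
    (integrableOn_rpow_mul_exp_neg_mul_rpow (by linarith) one_pos hr)
  refine h.congr (ae_of_all _ fun s => ?_)
  simp only [smul_eq_mul, Real.rpow_one]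
  rw [← Real.exp_mul, ← mul_assoc, ← Real.exp_add, ← Real.exp_add]
  congr 1; ring

theorem gam_integral {a r : ℝ} (ha : 0 < a) (hr : 0 < r) :
    ∫ s : ℝ, Real.exp (a * s - r * Real.exp s) = (1 / r) ^ a * Real.Gamma a := by
  rw [← Real.integral_rpow_mul_exp_neg_mul_Ioi ha hr, cov_int]
  refine integral_congr_ae (ae_of_all _ fun s => ?_)
  simp only [smul_eq_mul]
  rw [← Real.exp_mul, ← mul_assoc, ← Real.exp_add, ← Real.exp_add]
  congr 1; ring

theorem gam_top {a r : ℝ} (hr : 0 < r) :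
    Tendsto (fun s : ℝ => Real.exp (a * s - r * Real.exp s)) atTop (𝓝 0) := by
  have h := (tendsto_rpow_mul_exp_neg_mul_atTop_nhds_zero a r hr).comp Real.tendsto_exp_atTop
  refine h.congr fun s => ?_
  simp only [Function.comp]
  rw [← Real.exp_mul, ← Real.exp_add]
  congr 1; ring

theorem gam_bot {a r : ℝ} (ha : 0 < a) (hr : 0 < r) :
    Tendsto (fun s : ℝ => Real.exp (a * s - r * Real.exp s)) atBot (𝓝 0) := by
  have h : Tendsto (fun s : ℝ => Real.exp (a * s)) atBot (𝓝 0) :=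
    Real.tendsto_exp_atBot.comp ((tendsto_const_mul_atBot_of_pos ha).2 tendsto_id)
  refine squeeze_zero (fun _ => (Real.exp_pos _).le) (fun s => ?_) h
  apply Real.exp_le_exp.2
  have := mul_pos hr (Real.exp_pos s)
  linarith

theorem shift_int (H : ℂ → ℂ) (hH : Differentiable ℂ H) {a r M t₀ t₁ : ℝ} (ha : 0 < a)
    (hr : 0 < r) (h01 : t₀ ≤ t₁)
    (hb : ∀ s t : ℝ, t₀ ≤ t → t ≤ t₁ →
      ‖H (s + t * Complex.I)‖ ≤ M * Real.exp (a * s - r * Real.exp s)) :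
    ∫ s : ℝ, H (s + t₀ * Complex.I) = ∫ s : ℝ, H (s + t₁ * Complex.I) := by
  have hc := hH.continuous
  have hint : ∀ t, t₀ ≤ t → t ≤ t₁ → Integrable (fun s : ℝ => H (s + t * Complex.I)) := by
    intro t h1 h2
    refine Integrable.mono' ((gam_integrable ha hr).const_mul M) ?_
      (ae_of_all _ fun s => hb s t h1 h2)
    exact (by fun_prop : Continuous fun s : ℝ => H (s + t * Complex.I)).aestronglyMeasurable
  have hside : ∀ l : Filter ℝ, Tendsto (fun s : ℝ => Real.exp (a * s - r * Real.exp s)) l (𝓝 0) →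
      Tendsto (fun s : ℝ => ∫ t in t₀..t₁, H (s + t * Complex.I)) l (𝓝 0) := by
    intro l hl
    have h2 : Tendsto (fun s : ℝ => (M * Real.exp (a * s - r * Real.exp s)) * |t₁ - t₀|) l (𝓝 0) := by
      simpa using (hl.const_mul M).mul_const |t₁ - t₀|
    refine squeeze_zero_norm (fun s => ?_) h2
    apply intervalIntegral.norm_integral_le_of_norm_le_const
    intro t ht
    rw [uIoc_of_le h01] at ht
    exact hb s t ht.1.le ht.2
  have hL0 := intervalIntegral_tendsto_integral (hint t₀ le_rfl h01) tendsto_neg_atTop_atBot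
    tendsto_id
  have hL1 := intervalIntegral_tendsto_integral (hint t₁ h01 le_rfl) tendsto_neg_atTop_atBot
    tendsto_id
  have hT := hside _ (gam_top (a := a) hr)
  have hB := (hside _ (gam_bot ha hr)).comp tendsto_neg_atTop_atBot
  have hz : ∀ S : ℝ, (((∫ x in (-S)..(id S), H (x + t₀ * Complex.I))
      - ∫ x in (-S)..(id S), H (x + t₁ * Complex.I)) +
          Complex.I • ∫ t in t₀..t₁, H (S + t * Complex.I)) -
        Complex.I • ∫ t in t₀..t₁, H ((-S : ℝ) + t * Complex.I) = 0 := by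
    intro S
    have := Complex.integral_boundary_rect_eq_zero_of_differentiableOn H
      (⟨-S, t₀⟩ : ℂ) (⟨S, t₁⟩ : ℂ) hH.differentiableOn
    simpa using this
  have hlim := ((hL0.sub hL1).add (hT.const_smul Complex.I)).sub (hB.const_smul Complex.I)
  have h0 : Tendsto (fun S : ℝ => (((∫ x in (-S)..(id S), H (x + t₀ * Complex.I))
      - ∫ x in (-S)..(id S), H (x + t₁ * Complex.I)) +
          Complex.I • ∫ t in t₀..t₁, H (S + t * Complex.I)) -
        Complex.I • ∫ t in t₀..t₁, H ((-S : ℝ) + t * Complex.I)) atTop (𝓝 0) := by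
    simp only [hz]; exact tendsto_const_nhds
  have := tendsto_nhds_unique hlim h0
  simp only [smul_zero, add_zero, sub_zero] at this
  exact sub_eq_zero.1 this

theorem exp_b1 {x : ℂ} (hx : 0 ≤ x.re) : ‖Complex.exp (-x)‖ ≤ 1 := by
  rw [Complex.norm_exp]; simpa using hx

theorem exp_b2 {x : ℂ} (hx : 0 ≤ x.re) : ‖Complex.exp (-x) - 1‖ ≤ ‖x‖ := by
  have hd : ∀ z : ℂ, HasDerivAt (fun z : ℂ => Complex.exp (-z)) (-Complex.exp (-z)) z := by
    intro z
    simpa using (hasDerivAt_neg z).cexp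
  have := Convex.norm_image_sub_le_of_norm_deriv_le (𝕜 := ℂ) (f := fun z : ℂ => Complex.exp (-z))
    (s := {z : ℂ | 0 ≤ z.re}) (x := 0) (y := x) (C := 1) (fun z _ => (hd z).differentiableAt)
    (fun z hz => by rw [(hd z).deriv, norm_neg]; exact exp_b1 hz)
    (convex_halfSpace_re_ge 0) (by simp) hx
  simpa using this

theorem exp_b3 {x : ℂ} (hx : 0 ≤ x.re) : ‖Complex.exp (-x) - 1 - (-1) * x‖ ≤ ‖x‖ ^ 2 := by
  have hd : ∀ z : ℂ, HasDerivAt (fun z : ℂ => Complex.exp (-z) + z) (-Complex.exp (-z) + 1) z := by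
    intro z
    exact ((hasDerivAt_neg z).cexp.add (hasDerivAt_id z)).congr_deriv (by simp)
  have := Convex.norm_image_sub_le_of_norm_deriv_le (𝕜 := ℂ)
    (f := fun z : ℂ => Complex.exp (-z) + z)
    (s := {z : ℂ | 0 ≤ z.re} ∩ Metric.closedBall 0 ‖x‖) (x := 0) (y := x) (C := ‖x‖)
    (fun z _ => (hd z).differentiableAt)
    (fun z hz => by
      rw [(hd z).deriv, ← norm_neg]
      have h1 := exp_b2 hz.1
      have h2 : ‖z‖ ≤ ‖x‖ := by simpa using hz.2
      refine le_trans (le_of_eq ?_) (h1.trans h2)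
      congr 1; ring)
    ((convex_halfSpace_re_ge 0).inter (convex_closedBall 0 _)) (by simp) ⟨hx, by simp⟩
  refine le_trans (le_of_eq ?_) (this.trans (le_of_eq ?_))
  · congr 1; simp; ring
  · simp; ring


theorem zre (s t a : ℝ) : (Complex.exp (a * (s + t * Complex.I))).re
    = Real.exp (a * s) * Real.cos (a * t) := by
  rw [Complex.exp_re]; simp

theorem zim (s t a : ℝ) : (Complex.exp (a * (s + t * Complex.I))).im
    = Real.exp (a * s) * Real.sin (a * t) := by
  rw [Complex.exp_im]; simp

theorem znorm (s t a : ℝ) : ‖Complex.exp (a * (s + t * Complex.I))‖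
    = Real.exp (a * s) := by
  rw [Complex.norm_exp]; simp

theorem osc_norm (s t y : ℝ) : ‖Complex.exp (Complex.I * y * Complex.exp (s + t * Complex.I))‖
    = Real.exp (-(y * Real.exp s * Real.sin t)) := by
  rw [Complex.norm_exp]
  congr 1
  have h1 := zim s t 1
  simp only [Complex.ofReal_one, one_mul] at h1
  simp [Complex.mul_re, h1]
  ring

def Hk (α y ε : ℝ) (G : ℂ → ℂ) (ζ : ℂ) : ℂ :=
  Complex.exp ζ * Complex.exp (Complex.I * y * Complex.exp ζ)
    * Complex.exp (-(Complex.exp ((2:ℝ) * ζ) / 2)) * G (ε * Complex.exp (α * ζ))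

def Kk (α y : ℝ) (ζ : ℂ) : ℂ :=
  Complex.exp ((1 + α : ℝ) * ζ) * Complex.exp (Complex.I * y * Complex.exp ζ)

theorem Kk_norm (α y s t : ℝ) (hy : 0 < y) (h : 1 / 2 ≤ Real.sin t) :
    ‖Kk α y (s + t * Complex.I)‖ ≤ 1 * Real.exp ((1 + α) * s - (y / 2) * Real.exp s) := by
  rw [Kk, norm_mul, znorm, osc_norm, ← Real.exp_add, one_mul]
  apply Real.exp_le_exp.2
  have := mul_pos hy (Real.exp_pos s)
  nlinarith

theorem sin_ge {t : ℝ} (h1 : Real.pi / 6 ≤ t) (h2 : t ≤ Real.pi / 2) : 1 / 2 ≤ Real.sin t := by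
  rw [← Real.sin_pi_div_six]
  exact Real.sin_le_sin_of_le_of_le_pi_div_two (by linarith [Real.pi_pos]) h2 h1

theorem Kk_int {α y : ℝ} (h0 : 0 < α) (hy : 0 < y) :
    ∫ s : ℝ, Kk α y (s + (Real.pi / 6 : ℝ) * Complex.I)
      = Complex.exp ((1 + α : ℝ) * ((Real.pi / 2 : ℝ) * Complex.I))
        * ((1 / y) ^ (1 + α) * Real.Gamma (1 + α) : ℝ) := by
  rw [shift_int (Kk α y) (by unfold Kk; fun_prop) (a := 1 + α) (r := y / 2) (M := 1)
    (t₁ := Real.pi / 2) (by linarith) (by linarith) (by linarith [Real.pi_pos])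
    (fun s t h1 h2 => Kk_norm α y s t hy (sin_ge h1 h2))]
  rw [← gam_integral (by linarith) hy, ← integral_complex_ofReal, ← integral_const_mul]
  refine integral_congr_ae (ae_of_all _ fun s => ?_)
  simp only [Kk]
  rw [mul_add, Complex.exp_add, Complex.exp_add]
  have : Complex.exp ((Real.pi / 2 : ℝ) * Complex.I) = Complex.I := by
    push_cast; exact Complex.exp_pi_div_two_mul_I
  rw [this, Complex.ofReal_exp, Complex.ofReal_sub, sub_eq_add_neg, Complex.exp_add]
  push_cast
  have h2 : Complex.I * y * (Complex.exp s * Complex.I) = -(y * Complex.exp s) := by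
    linear_combination (y * Complex.exp s : ℂ) * Complex.I_mul_I
  rw [h2]; ring

theorem Hk_norm {α y ε s t : ℝ} {G : ℂ → ℂ} (h0 : 0 < α) (h2 : α < 2) (hy : 0 < y) (hε : 0 < ε)
    (hG1 : ∀ x : ℂ, 0 ≤ x.re → ‖G x‖ ≤ ‖x‖) (ht0 : 0 ≤ t) (ht1 : t ≤ Real.pi / 6) :
    ‖Hk α y ε G (s + t * Complex.I)‖
      ≤ (ε * Real.exp 1) * Real.exp ((1 + α) * s - 1 * Real.exp s) := by
  have hpi := Real.pi_pos
  have hx : 0 ≤ ((ε : ℂ) * Complex.exp (α * (s + t * Complex.I))).re := by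
    rw [Complex.re_ofReal_mul, zre]
    have : 0 ≤ Real.cos (α * t) := Real.cos_nonneg_of_mem_Icc ⟨by nlinarith, by nlinarith⟩
    positivity
  have hGx := hG1 _ hx
  rw [norm_mul, znorm, Complex.norm_real, Real.norm_eq_abs, abs_of_pos hε] at hGx
  have hz1 := znorm s t 1
  simp only [Complex.ofReal_one, one_mul] at hz1
  have hq : ‖Complex.exp (-(Complex.exp ((2:ℝ) * (s + t * Complex.I)) / 2))‖
      ≤ Real.exp (1 - Real.exp s) := by
    rw [Complex.norm_exp]
    apply Real.exp_le_exp.2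
    have h3 := zre s t 2
    have h4 : (-(Complex.exp ((2:ℝ) * (s + t * Complex.I)) / 2)).re
      = -((Complex.exp ((2:ℝ) * (s + t * Complex.I))).re / 2) := by simp
    rw [h4, h3]
    have hcos : 1 / 2 ≤ Real.cos (2 * t) := by
      rw [← Real.cos_pi_div_three]
      exact Real.cos_le_cos_of_nonneg_of_le_pi (by linarith) (by linarith) (by linarith)
    have h5 : Real.exp (2 * s) = Real.exp s ^ 2 := by rw [← Real.exp_nat_mul]; simp
    rw [h5]
    nlinarith [sq_nonneg (Real.exp s / 2 - 1), sq_nonneg (Real.exp s)]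
  have ho : ‖Complex.exp (Complex.I * y * Complex.exp (s + t * Complex.I))‖ ≤ 1 := by
    rw [osc_norm, Real.exp_le_one_iff]
    have : 0 ≤ Real.sin t := Real.sin_nonneg_of_nonneg_of_le_pi ht0 (by linarith)
    have := Real.exp_pos s
    have : 0 ≤ y * Real.exp s * Real.sin t := by positivity
    linarith
  rw [Hk, norm_mul, norm_mul, norm_mul, hz1]
  calc _ ≤ Real.exp s * 1 * Real.exp (1 - Real.exp s) * (ε * Real.exp (α * s)) := by
        gcongr
    _ = ε * (Real.exp s * Real.exp (1 - Real.exp s) * Real.exp (α * s)) := by ring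
    _ = _ := by
        rw [← Real.exp_add, ← Real.exp_add, mul_assoc ε, ← Real.exp_add]
        congr 2; ring

theorem Hk_diff {α y ε : ℝ} {G : ℂ → ℂ} (hG : Differentiable ℂ G) :
    Differentiable ℂ (Hk α y ε G) := by
  unfold Hk; fun_prop

theorem Hk_sub {α y ε s : ℝ} {κ : ℂ} {G : ℂ → ℂ} (h0 : 0 < α) (h2 : α < 2) (hε : 0 < ε)
    (hG1 : ∀ x : ℂ, 0 ≤ x.re → ‖G x‖ ≤ ‖x‖)
    (hG2 : ∀ x : ℂ, 0 ≤ x.re → ‖G x - κ * x‖ ≤ ‖x‖ ^ 2) :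
    ‖Hk α y ε G (s + (Real.pi / 6 : ℝ) * Complex.I)
        - κ * ε * Kk α y (s + (Real.pi / 6 : ℝ) * Complex.I)‖
      ≤ ε / 2 * Real.exp ((3 + α) * s - (y / 2) * Real.exp s)
        + ε ^ 2 * Real.exp ((1 + 2 * α) * s - (y / 2) * Real.exp s) := by
  have hpi := Real.pi_pos
  set t := Real.pi / 6 with ht
  set ζ : ℂ := s + t * Complex.I with hζ
  set x : ℂ := ε * Complex.exp (α * ζ) with hxdef
  set q : ℂ := Complex.exp ((2:ℝ) * ζ) / 2 with hq
  have hx : 0 ≤ x.re := by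
    rw [hxdef, Complex.re_ofReal_mul, zre]
    have : 0 ≤ Real.cos (α * t) := Real.cos_nonneg_of_mem_Icc ⟨by nlinarith, by nlinarith⟩
    positivity
  have hxn : ‖x‖ = ε * Real.exp (α * s) := by
    rw [hxdef, norm_mul, znorm, Complex.norm_real, Real.norm_eq_abs, abs_of_pos hε]
  have hq0 : 0 ≤ q.re := by
    have h4 : q.re = (Complex.exp ((2:ℝ) * (s + t * Complex.I))).re / 2 := by simp [hq, hζ]
    rw [h4, zre]
    have : 0 ≤ Real.cos (2 * t) := Real.cos_nonneg_of_mem_Icc ⟨by linarith, by linarith⟩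
    positivity
  have hqn : ‖q‖ = Real.exp (2 * s) / 2 := by
    rw [hq, norm_div, znorm]; simp
  have hz1 := znorm s t 1
  simp only [Complex.ofReal_one, one_mul] at hz1
  have ho : ‖Complex.exp (Complex.I * y * Complex.exp ζ)‖ = Real.exp (-(y / 2 * Real.exp s)) := by
    rw [hζ, osc_norm, ht, Real.sin_pi_div_six]; congr 1; ring
  have hid : Hk α y ε G ζ - κ * ε * Kk α y ζ
      = Complex.exp ζ * Complex.exp (Complex.I * y * Complex.exp ζ)
        * ((Complex.exp (-q) - 1) * G x + (G x - κ * x)) := by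
    have : Complex.exp ((1 + α : ℝ) * ζ) = Complex.exp ζ * Complex.exp (α * ζ) := by
      rw [← Complex.exp_add]; congr 1; push_cast; ring
    simp only [Hk, Kk, this, ← hxdef, ← hq]
    rw [hxdef]; ring
  have hA : ‖(Complex.exp (-q) - 1) * G x + (G x - κ * x)‖
      ≤ Real.exp (2 * s) / 2 * (ε * Real.exp (α * s)) + (ε * Real.exp (α * s)) ^ 2 := by
    refine (norm_add_le _ _).trans (add_le_add ?_ ?_)
    · rw [norm_mul]
      have h1 := exp_b2 hq0
      have h2 := hG1 x hx
      rw [hqn] at h1; rw [hxn] at h2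
      gcongr
    · have := hG2 x hx
      rwa [hxn] at this
  rw [hid, norm_mul, norm_mul, hz1, ho]
  refine (mul_le_mul_of_nonneg_left hA (by positivity)).trans (le_of_eq ?_)
  have e1 : Real.exp ((3 + α) * s - (y / 2) * Real.exp s)
      = Real.exp s * Real.exp (-(y / 2 * Real.exp s)) * (Real.exp (2 * s) * Real.exp (α * s)) := by
    simp only [← Real.exp_add]; congr 1; ring
  have e2 : Real.exp ((1 + 2 * α) * s - (y / 2) * Real.exp s)
      = Real.exp s * Real.exp (-(y / 2 * Real.exp s)) * (Real.exp (α * s) * Real.exp (α * s)) := by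
    simp only [← Real.exp_add]; congr 1; ring
  rw [e1, e2]; ring

theorem Hk_main {α y ε : ℝ} {κ : ℂ} {G : ℂ → ℂ} (h0 : 0 < α) (h2 : α < 2) (hy : 0 < y)
    (hε : 0 < ε) (hG : Differentiable ℂ G)
    (hG1 : ∀ x : ℂ, 0 ≤ x.re → ‖G x‖ ≤ ‖x‖)
    (hG2 : ∀ x : ℂ, 0 ≤ x.re → ‖G x - κ * x‖ ≤ ‖x‖ ^ 2) :
    ‖(∫ s : ℝ, Hk α y ε G s) - κ * ε *
      (Complex.exp ((1 + α : ℝ) * ((Real.pi / 2 : ℝ) * Complex.I))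
        * ((1 / y) ^ (1 + α) * Real.Gamma (1 + α) : ℝ))‖
      ≤ ε / 2 * ((1 / (y / 2)) ^ (3 + α) * Real.Gamma (3 + α))
        + ε ^ 2 * ((1 / (y / 2)) ^ (1 + 2 * α) * Real.Gamma (1 + 2 * α)) := by
  have hpi := Real.pi_pos
  have hsh := shift_int (Hk α y ε G) (Hk_diff hG) (a := 1 + α) (r := 1) (M := ε * Real.exp 1)
    (t₀ := 0) (t₁ := Real.pi / 6) (by linarith) one_pos (by linarith)
    (fun s t a b => Hk_norm h0 h2 hy hε hG1 a b)
  simp only [Complex.ofReal_zero, zero_mul, add_zero] at hsh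
  have hc1 : Continuous fun s : ℝ => Hk α y ε G (s + (Real.pi / 6 : ℝ) * Complex.I) := by
    have := (Hk_diff (α := α) (y := y) (ε := ε) hG).continuous
    fun_prop
  have hc2 : Continuous fun s : ℝ => Kk α y (s + (Real.pi / 6 : ℝ) * Complex.I) := by
    unfold Kk; fun_prop
  have hi1 : Integrable fun s : ℝ => Hk α y ε G (s + (Real.pi / 6 : ℝ) * Complex.I) :=
    Integrable.mono' ((gam_integrable (a := 1 + α) (r := 1) (by linarith) one_pos).const_mul _)
      hc1.aestronglyMeasurable
      (ae_of_all _ fun s => Hk_norm h0 h2 hy hε hG1 (by linarith) le_rfl)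
  have hi2 : Integrable fun s : ℝ => Kk α y (s + (Real.pi / 6 : ℝ) * Complex.I) :=
    Integrable.mono' ((gam_integrable (a := 1 + α) (r := y / 2) (by linarith)
      (by linarith)).const_mul _)
      hc2.aestronglyMeasurable
      (ae_of_all _ fun s => Kk_norm α y s _ hy (sin_ge le_rfl (by linarith)))
  rw [hsh, ← Kk_int h0 hy, ← integral_const_mul, ← integral_sub hi1 (hi2.const_mul _)]
  have g1 := gam_integrable (a := 3 + α) (r := y / 2) (by linarith) (by linarith)
  have g2 := gam_integrable (a := 1 + 2 * α) (r := y / 2) (by linarith) (by linarith)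
  refine (norm_integral_le_of_norm_le ((g1.const_mul (ε / 2)).add (g2.const_mul (ε ^ 2)))
    (ae_of_all _ fun s => Hk_sub h0 h2 hε hG1 hG2)).trans (le_of_eq ?_)
  rw [← gam_integral (by linarith) (by linarith), ← gam_integral (by linarith) (by linarith),
    ← integral_const_mul, ← integral_const_mul,
    ← integral_add (g1.const_mul (ε / 2)) (g2.const_mul (ε ^ 2))]
  rfl

theorem Hk_integrable {α y ε : ℝ} {G : ℂ → ℂ} (h0 : 0 < α) (h2 : α < 2) (hy : 0 < y)
    (hε : 0 < ε) (hG : Differentiable ℂ G)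
    (hG1 : ∀ x : ℂ, 0 ≤ x.re → ‖G x‖ ≤ ‖x‖) : Integrable fun s : ℝ => Hk α y ε G s := by
  have hc1 : Continuous fun s : ℝ => Hk α y ε G s := by
    have := (Hk_diff (α := α) (y := y) (ε := ε) hG).continuous
    fun_prop
  refine Integrable.mono' ((gam_integrable (a := 1 + α) (r := 1) (by linarith) one_pos).const_mul
    (ε * Real.exp 1))
      hc1.aestronglyMeasurable (ae_of_all _ fun s => ?_)
  simpa using Hk_norm (s := s) (t := 0) h0 h2 hy hε hG1 le_rfl (by linarith [Real.pi_pos])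

/-- Real version. -/
theorem real_main {α y ε κ : ℝ} {G : ℂ → ℂ} {g : ℝ → ℝ} (h0 : 0 < α) (h2 : α < 2) (hy : 1 ≤ y)
    (hε : 0 < ε) (hG : Differentiable ℂ G) (hgG : ∀ x : ℝ, G x = (g x : ℂ))
    (hG1 : ∀ x : ℂ, 0 ≤ x.re → ‖G x‖ ≤ ‖x‖)
    (hG2 : ∀ x : ℂ, 0 ≤ x.re → ‖G x - κ * x‖ ≤ ‖x‖ ^ 2) :
    |(∫ u in Ioi (0:ℝ), Real.cos (y * u) * Real.exp (-(u ^ 2) / 2) * g (ε * u ^ α))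
      + κ * ε * (Real.sin (Real.pi * α / 2) * Real.Gamma (1 + α)) * y ^ (-(1 + α))|
      ≤ (2 ^ (3 + α) * Real.Gamma (3 + α) + 2 ^ (1 + 2 * α) * Real.Gamma (1 + 2 * α))
        * (ε * y ^ (-(1 + α)) * (y ^ (-(2:ℝ)) + ε)) := by
  have hy0 : 0 < y := by linarith
  have hm := Hk_main (y := y) h0 h2 hy0 hε hG hG1 hG2
  have hint : (∫ u in Ioi (0:ℝ), Real.cos (y * u) * Real.exp (-(u ^ 2) / 2) * g (ε * u ^ α))
      = (∫ s : ℝ, Hk α y ε G s).re := by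
    rw [cov_int, ← RCLike.re_eq_complex_re, ← integral_re (Hk_integrable h0 h2 hy0 hε hG hG1)]
    refine integral_congr_ae (ae_of_all _ fun s => ?_)
    simp only [smul_eq_mul, RCLike.re_eq_complex_re, Hk]
    have e1 : (ε : ℂ) * Complex.exp (α * s) = ((ε * Real.exp s ^ α : ℝ) : ℂ) := by
      rw [← Real.exp_mul]; push_cast; rw [mul_comm (s:ℂ)]
    have e2 : Complex.exp (-(Complex.exp ((2:ℝ) * s) / 2))
        = ((Real.exp (-(Real.exp s ^ 2) / 2) : ℝ) : ℂ) := by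
      rw [← Real.exp_nat_mul]; push_cast; congr 1; ring
    have e3 : Complex.exp (Complex.I * y * Complex.exp s)
        = Complex.exp ((y * Real.exp s : ℝ) * Complex.I) := by
      push_cast; congr 1; ring
    rw [e1, e2, e3, hgG, ← Complex.ofReal_exp, Complex.re_mul_ofReal, Complex.re_mul_ofReal,
      Complex.re_ofReal_mul, Complex.exp_ofReal_mul_I_re]
    ring
  have hre : ((κ : ℂ) * ε *
      (Complex.exp ((1 + α : ℝ) * ((Real.pi / 2 : ℝ) * Complex.I))
        * ((1 / y) ^ (1 + α) * Real.Gamma (1 + α) : ℝ))).re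
      = -(κ * ε * (Real.sin (Real.pi * α / 2) * Real.Gamma (1 + α)) * y ^ (-(1 + α))) := by
    rw [← Complex.ofReal_mul, Complex.re_ofReal_mul, Complex.re_mul_ofReal, ← mul_assoc (Complex.ofReal _),
      ← Complex.ofReal_mul, Complex.exp_ofReal_mul_I_re]
    have : Real.cos ((1 + α) * (Real.pi / 2)) = -Real.sin (Real.pi * α / 2) := by
      rw [← Real.cos_add_pi_div_two]; congr 1; ring
    rw [this, one_div, Real.inv_rpow hy0.le, Real.rpow_neg hy0.le]
    ring
  have hfin := (Complex.abs_re_le_norm _).trans hm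
  rw [Complex.sub_re, hre, ← hint, sub_neg_eq_add] at hfin
  refine hfin.trans ?_
  have p1 : ∀ b : ℝ, (1 / (y / 2)) ^ b = 2 ^ b * y ^ (-b) := by
    intro b
    rw [one_div_div, Real.div_rpow (by norm_num) hy0.le, Real.rpow_neg hy0.le]; rfl
  rw [p1, p1]
  have q1 : y ^ (-(3 + α)) = y ^ (-(1 + α)) * y ^ (-(2:ℝ)) := by
    rw [← Real.rpow_add hy0]; congr 1; ring
  have q2 : y ^ (-(1 + 2 * α)) ≤ y ^ (-(1 + α)) :=
    Real.rpow_le_rpow_of_exponent_le hy (by linarith)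
  rw [q1]
  have G3 := Real.Gamma_pos_of_pos (show 0 < 3 + α by linarith)
  have G1 := Real.Gamma_pos_of_pos (show 0 < 1 + 2 * α by linarith)
  set A := 2 ^ (3 + α) * Real.Gamma (3 + α) with hA
  set B := 2 ^ (1 + 2 * α) * Real.Gamma (1 + 2 * α) with hB
  have hA0 : 0 ≤ A := by positivity
  have hB0 : 0 ≤ B := by positivity
  set p := y ^ (-(1 + α)) with hp
  have hp0 : 0 ≤ p := by positivity
  set r := y ^ (-(2:ℝ)) with hr
  have hr0 : 0 ≤ r := by positivity
  calc _ = ε / 2 * p * r * A + ε ^ 2 * B * y ^ (-(1 + 2 * α)) := by rw [hA, hB]; ring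
    _ ≤ ε * p * r * A + ε ^ 2 * B * p := by
        gcongr
        linarith
    _ ≤ _ := by
        have : 0 ≤ ε * p * r * B := by positivity
        have : 0 ≤ ε ^ 2 * p * A := by positivity
        nlinarith

theorem gauss_cont : Continuous gauss := by unfold gauss; fun_prop

theorem gauss_pos (x : ℝ) : 0 < gauss x := by
  unfold gauss
  have := Real.pi_pos
  positivity

theorem gauss_integrable : Integrable gauss := by
  unfold gauss
  refine Integrable.const_mul ?_ _
  refine (integrable_exp_neg_mul_sq (b := 1 / 2) (by norm_num)).congr (ae_of_all _ fun x => ?_)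
  simp only; congr 1; ring

theorem gauss_cos (a b : ℝ) :
    ∫ x : ℝ, gauss x * Real.cos (a + b * x) = Real.cos a * Real.exp (-(b ^ 2) / 2) := by
  have h := fourierIntegral_gaussian (b := 1 / 2) (by norm_num) (b : ℂ)
  have hc : Integrable fun x : ℝ => (gauss x : ℂ) * Complex.exp ((a + b * x : ℝ) * Complex.I) := by
    refine Integrable.mono' gauss_integrable ?_ (ae_of_all _ fun x => ?_)
    · have := gauss_cont
      exact (by fun_prop : Continuous fun x : ℝ =>
        (gauss x : ℂ) * Complex.exp ((a + b * x : ℝ) * Complex.I)).aestronglyMeasurable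
    · rw [norm_mul, Complex.norm_exp_ofReal_mul_I, Complex.norm_real, Real.norm_eq_abs,
        abs_of_pos (gauss_pos x), mul_one]
  have hs : (0:ℝ) < Real.sqrt (2 * Real.pi) := Real.sqrt_pos.2 (by linarith [Real.pi_pos])
  have h3 : ∫ x : ℝ, (gauss x : ℂ) * Complex.exp ((a + b * x : ℝ) * Complex.I)
      = ((Real.exp (-(b ^ 2) / 2) : ℝ) : ℂ) * Complex.exp (a * Complex.I) := by
    have e : ∀ x : ℝ, (gauss x : ℂ) * Complex.exp ((a + b * x : ℝ) * Complex.I)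
        = (((Real.sqrt (2 * Real.pi))⁻¹ : ℝ) : ℂ) * Complex.exp (a * Complex.I)
          * (Complex.exp (Complex.I * b * x) * Complex.exp (-(1 / 2) * (x : ℂ) ^ 2)) := by
      intro x
      unfold gauss
      push_cast
      have e1 : Complex.exp ((a + b * x) * Complex.I)
          = Complex.exp (a * Complex.I) * Complex.exp (Complex.I * b * x) := by
        rw [← Complex.exp_add]; congr 1; ring
      have e2 : Complex.exp (-(x : ℂ) ^ 2 / 2) = Complex.exp (-(1 / 2) * (x : ℂ) ^ 2) := by
        congr 1; ring
      rw [e1, e2]; ring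
    simp only [e]
    rw [integral_const_mul, h]
    have e3 : ((Real.pi : ℂ) / (1 / 2)) ^ (1 / 2 : ℂ) = ((Real.sqrt (2 * Real.pi) : ℝ) : ℂ) := by
      rw [Real.sqrt_eq_rpow, Complex.ofReal_cpow (by linarith [Real.pi_pos])]
      push_cast; congr 1; ring
    have e4 : Complex.exp (-(b : ℂ) ^ 2 / (4 * (1 / 2))) = ((Real.exp (-(b ^ 2) / 2) : ℝ) : ℂ) := by
      push_cast; congr 1; ring
    rw [e3, e4, Complex.ofReal_inv]
    have : ((Real.sqrt (2 * Real.pi) : ℝ) : ℂ) ≠ 0 := by exact_mod_cast hs.ne'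
    field_simp
  have h4 := congrArg Complex.re h3
  rw [← RCLike.re_eq_complex_re, ← integral_re hc] at h4
  simp only [RCLike.re_eq_complex_re, Complex.re_ofReal_mul, Complex.exp_ofReal_mul_I_re] at h4
  rw [h4]; ring

theorem gauss_eq (y : ℝ) :
    gauss y = (2 * Real.pi)⁻¹ * ∫ u : ℝ, Real.cos (y * u) * Real.exp (-(u ^ 2) / 2) := by
  have h := gauss_cos 0 y
  have hs : (0:ℝ) < Real.sqrt (2 * Real.pi) := Real.sqrt_pos.2 (by linarith [Real.pi_pos])
  have hs2 : Real.sqrt (2 * Real.pi) * Real.sqrt (2 * Real.pi) = 2 * Real.pi :=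
    Real.mul_self_sqrt (by linarith [Real.pi_pos])
  have e : ∀ u : ℝ, Real.cos (y * u) * Real.exp (-(u ^ 2) / 2)
      = Real.sqrt (2 * Real.pi) * (gauss u * Real.cos (0 + y * u)) := by
    intro u; unfold gauss; rw [zero_add]; field_simp
  simp only [e]
  rw [integral_const_mul, h, Real.cos_zero, gauss]
  have h3 : (2 * Real.pi)⁻¹ * Real.sqrt (2 * Real.pi) = (Real.sqrt (2 * Real.pi))⁻¹ := by
    nth_rewrite 1 [← hs2]
    rw [mul_inv, mul_assoc, inv_mul_cancel₀ hs.ne', mul_one]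
  rw [← mul_assoc, h3, one_mul]

theorem fourier_swap {m : ℝ → ℝ} (hm : Integrable m) (y : ℝ) {w : ℝ} (hw : 0 < w) :
    ∫ z : ℝ, gauss (y - w * z) * ((2 * Real.pi)⁻¹ * ∫ u : ℝ, Real.cos (z * u) * m u)
      = (2 * Real.pi)⁻¹ * ∫ v : ℝ, Real.cos (y * v) * Real.exp (-(v ^ 2) / 2) * m (w * v) := by
  have hm' : Integrable fun v => m (w * v) := hm.comp_mul_left' hw.ne'
  have hg' : Integrable fun x => gauss (y - x) := gauss_integrable.comp_sub_left y
  -- scale in `u`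
  have e1 : ∀ z : ℝ, gauss (y - w * z) * ((2 * Real.pi)⁻¹ * ∫ u : ℝ, Real.cos (z * u) * m u)
      = (2 * Real.pi)⁻¹ * (w * (gauss (y - w * z) * ∫ v : ℝ, Real.cos ((w * z) * v) * m (w * v))) := by
    intro z
    have := Measure.integral_comp_mul_left (fun u => Real.cos (z * u) * m u) w
    rw [abs_of_pos (inv_pos.2 hw), smul_eq_mul] at this
    have h2 : ∫ u : ℝ, Real.cos (z * u) * m u
        = w * ∫ v : ℝ, Real.cos ((w * z) * v) * m (w * v) := by
      have h3 : ∀ v, Real.cos ((w * z) * v) = Real.cos (z * (w * v)) := fun v => by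
        congr 1; ring
      simp only [h3, this]
      field_simp
    rw [h2]; ring
  simp only [e1]
  rw [integral_const_mul, integral_const_mul]
  congr 1
  have h4 := Measure.integral_comp_mul_left
    (fun x => gauss (y - x) * ∫ v : ℝ, Real.cos (x * v) * m (w * v)) w
  rw [abs_of_pos (inv_pos.2 hw), smul_eq_mul] at h4
  rw [h4, ← mul_assoc, mul_inv_cancel₀ hw.ne', one_mul]
  simp only [← integral_const_mul]
  rw [integral_integral_swap]
  · refine integral_congr_ae (ae_of_all _ fun v => ?_)
    have e2 : ∀ x : ℝ, gauss (y - x) * (Real.cos (x * v) * m (w * v))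
        = (gauss (y - x) * Real.cos (x * v)) * m (w * v) := fun x => by ring
    simp only [e2]
    rw [integral_mul_const]
    congr 1
    have h5 := integral_sub_left_eq_self (fun x => gauss x * Real.cos ((y - x) * v)) volume y
    simp only [sub_sub_cancel] at h5
    rw [h5]
    have h6 := gauss_cos (y * v) (-v)
    rw [neg_sq] at h6
    rw [← h6]
    refine integral_congr_ae (ae_of_all _ fun x => ?_)
    simp only; congr 2; ring
  · have h7 : Integrable (fun p : ℝ × ℝ => gauss (y - p.1) * m (w * p.2)) (volume.prod volume) :=
      hg'.mul_prod hm'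
    refine h7.mono ?_ (ae_of_all _ fun p => ?_)
    · have h8 := (h7.aestronglyMeasurable).mul
        ((by fun_prop : Continuous fun p : ℝ × ℝ => Real.cos (p.1 * p.2)).aestronglyMeasurable)
      refine h8.congr (ae_of_all _ fun p => ?_)
      simp only [Pi.mul_apply, Function.uncurry]; ring
    · simp only [Function.uncurry, norm_mul]
      have : ‖Real.cos (p.1 * p.2)‖ ≤ 1 := by
        rw [Real.norm_eq_abs]; exact Real.abs_cos_le_one _
      have h9 := norm_nonneg (m (w * p.2))
      gcongr
      nlinarith

theorem m1_integrable {α : ℝ} (h0 : 0 < α) (s : ℝ) (hs : 0 ≤ s) {b : ℝ} (hb : 0 < b) :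
    Integrable fun u : ℝ => |u| ^ s * Real.exp (-b * |u| ^ α) := by
  have h := integrableOn_rpow_mul_exp_neg_mul_rpow (p := α) (s := s) (b := b)
    (by linarith) h0 hb
  have h2 : IntegrableOn (fun u : ℝ => |u| ^ s * Real.exp (-b * |u| ^ α)) (Ioi 0) := by
    refine h.congr_fun (fun x hx => ?_) measurableSet_Ioi
    simp only [abs_of_pos (show (0:ℝ) < x from hx)]
  rw [← integrableOn_univ, ← @Iic_union_Ioi _ _ (0 : ℝ), integrableOn_union]
  refine ⟨?_, h2⟩
  rw [← Measure.map_neg_eq_self (volume : Measure ℝ)]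
  let m : MeasurableEmbedding fun x : ℝ => -x := (Homeomorph.neg ℝ).measurableEmbedding
  rw [m.integrableOn_map_iff]
  simp_rw [Function.comp_def, abs_neg, neg_preimage, neg_Iic, neg_zero]
  exact Iff.mpr integrableOn_Ici_iff_integrableOn_Ioi h2

def Gs (α z s : ℝ) : ℝ := ∫ v : ℝ, Real.cos (z * v) * Real.exp (-(|v| ^ α * s ^ (-α)))

theorem abs_rpow_cont {α : ℝ} (h0 : 0 < α) : Continuous fun v : ℝ => |v| ^ α :=
  continuous_abs.rpow_const fun _ => Or.inr h0.le

theorem m_int0 {α : ℝ} (h0 : 0 < α) : Integrable fun u : ℝ => Real.exp (-(|u| ^ α)) := by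
  simpa using m1_integrable h0 0 le_rfl one_pos

theorem m_int1 {α : ℝ} (h0 : 0 < α) :
    Integrable fun u : ℝ => α * |u| ^ α * Real.exp (-(|u| ^ α)) := by
  simpa [mul_assoc] using (m1_integrable h0 α h0.le one_pos).const_mul α

theorem Gs_deriv {α : ℝ} (h0 : 0 < α) (z : ℝ) :
    HasDerivAt (Gs α z) (∫ v : ℝ, Real.cos (z * v) * (α * |v| ^ α * Real.exp (-(|v| ^ α)))) 1 := by
  have hac := abs_rpow_cont h0
  have key := hasDerivAt_integral_of_dominated_loc_of_deriv_le (𝕜 := ℝ) (μ := (volume : Measure ℝ))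
    (F := fun s v : ℝ => Real.cos (z * v) * Real.exp (-(|v| ^ α * s ^ (-α))))
    (F' := fun s v : ℝ => Real.cos (z * v) * (α * |v| ^ α * s ^ (-α - 1)
      * Real.exp (-(|v| ^ α * s ^ (-α)))))
    (x₀ := 1) (s := Ioo (1/2) 2)
    (bound := fun v => (α * (1 / 2 : ℝ) ^ (-α - 1)) *
      (|v| ^ α * Real.exp (-((2:ℝ) ^ (-α)) * |v| ^ α)))
    (Ioo_mem_nhds (by norm_num) (by norm_num))
    (Eventually.of_forall fun s => Continuous.aestronglyMeasurable (by fun_prop))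
    ?_ (Continuous.aestronglyMeasurable (by fun_prop)) ?_
    ((m1_integrable h0 α h0.le (by positivity)).const_mul _) ?_
  · have h2 := key.2
    simp only [Real.one_rpow, mul_one] at h2
    exact h2
  · simp only [Real.one_rpow, mul_one]
    refine (m_int0 h0).mono' (Continuous.aestronglyMeasurable (by fun_prop))
      (ae_of_all _ fun v => ?_)
    rw [norm_mul, Real.norm_eq_abs, Real.norm_eq_abs, Real.abs_exp]
    have := Real.abs_cos_le_one (z * v)
    have := Real.exp_pos (-(|v| ^ α))
    nlinarith
  · refine ae_of_all _ fun v s hs => ?_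
    have hs0 : 0 < s := by linarith [hs.1]
    have hv : 0 ≤ |v| ^ α := by positivity
    rw [norm_mul, Real.norm_eq_abs, Real.norm_eq_abs]
    have h1 := Real.abs_cos_le_one (z * v)
    have h3 : s ^ (-α - 1) ≤ (1 / 2 : ℝ) ^ (-α - 1) :=
      Real.rpow_le_rpow_of_nonpos (by norm_num) hs.1.le (by linarith)
    have h4 : (2:ℝ) ^ (-α) ≤ s ^ (-α) :=
      Real.rpow_le_rpow_of_nonpos hs0 hs.2.le (by linarith)
    have h5 : Real.exp (-(|v| ^ α * s ^ (-α))) ≤ Real.exp (-((2:ℝ) ^ (-α)) * |v| ^ α) := by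
      apply Real.exp_le_exp.2; nlinarith
    rw [abs_of_nonneg (a := α * |v| ^ α * s ^ (-α - 1) * Real.exp (-(|v| ^ α * s ^ (-α))))
      (by positivity)]
    calc _ ≤ 1 * (α * |v| ^ α * (1 / 2 : ℝ) ^ (-α - 1)
          * Real.exp (-((2:ℝ) ^ (-α)) * |v| ^ α)) := by gcongr
      _ = _ := by ring
  · refine ae_of_all _ fun v s hs => ?_
    have hs0 : 0 < s := by linarith [hs.1]
    have h1 := (Real.hasDerivAt_rpow_const (x := s) (p := -α) (Or.inl hs0.ne'))
    have h2 := ((h1.const_mul (|v| ^ α)).neg.exp).const_mul (Real.cos (z * v))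
    refine h2.congr_deriv ?_
    simp only [Pi.neg_apply]
    ring

theorem Gs_eq {α : ℝ} (z : ℝ) {s : ℝ} (hs : 0 < s) :
    stableDensity α (s * z) = (2 * Real.pi)⁻¹ * (s⁻¹ * Gs α z s) := by
  unfold stableDensity Gs
  congr 1
  have := Measure.integral_comp_mul_left
    (fun v => Real.cos (z * v) * Real.exp (-(|v| ^ α * s ^ (-α)))) s
  rw [abs_of_pos (inv_pos.2 hs), smul_eq_mul] at this
  rw [← this]
  refine integral_congr_ae (ae_of_all _ fun v => ?_)
  simp only
  rw [abs_mul, abs_of_pos hs, Real.mul_rpow hs.le (abs_nonneg v), Real.rpow_neg hs.le]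
  have : s ^ α ≠ 0 := (Real.rpow_pos_of_pos hs α).ne'
  congr 2
  · ring
  · field_simp

theorem Dop_eq {α : ℝ} (h0 : 0 < α) {z : ℝ} (hz : z ≠ 0) :
    Dop (stableDensity α) z
      = (2 * Real.pi)⁻¹ * ∫ v : ℝ, Real.cos (z * v) * (α * |v| ^ α * Real.exp (-(|v| ^ α))) := by
  set D := ∫ v : ℝ, Real.cos (z * v) * (α * |v| ^ α * Real.exp (-(|v| ^ α))) with hD
  have hd := Gs_deriv h0 z
  have h1 : HasDerivAt (fun s : ℝ => (2 * Real.pi)⁻¹ * (s⁻¹ * Gs α z s))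
      ((2 * Real.pi)⁻¹ * (-Gs α z 1 + D)) (z / z) := by
    rw [div_self hz]
    have := ((hasDerivAt_inv (one_ne_zero (α := ℝ))).mul hd).const_mul (2 * Real.pi)⁻¹
    refine this.congr_deriv ?_
    simp [hD]
  have h2 : HasDerivAt (fun x : ℝ => x / z) (1 / z) z := (hasDerivAt_id z).div_const z
  have h3 := HasDerivAt.comp (h := fun x : ℝ => x / z) z h1 h2
  have h4 : HasDerivAt (stableDensity α) ((2 * Real.pi)⁻¹ * (-Gs α z 1 + D) * (1 / z)) z := by
    refine h3.congr_of_eventuallyEq ?_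
    have h5 : ∀ᶠ x in 𝓝 z, 0 < x / z :=
      h2.continuousAt.eventually (lt_mem_nhds (by show 0 < z / z; rw [div_self hz]; exact one_pos))
    filter_upwards [h5] with x hx
    have := Gs_eq (α := α) z hx
    rw [div_mul_cancel₀ _ hz] at this
    exact this
  have h6 := Gs_eq (α := α) z one_pos
  rw [one_mul, inv_one, one_mul] at h6
  rw [Dop, h4.deriv, h6]
  field_simp
  ring

theorem fFun_eq {α : ℝ} (h0 : 0 < α) (y : ℝ) {w : ℝ} (hw : 0 < w) :
    fFun α y w = Real.pi⁻¹ * ∫ u in Ioi (0:ℝ), Real.cos (y * u) * Real.exp (-(u ^ 2) / 2)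
      * Real.exp (-(w ^ α * u ^ α)) := by
  have h := fourier_swap (m_int0 h0) y hw
  unfold fFun stableDensity
  rw [h]
  have h2 := integral_comp_abs (f := fun u => Real.cos (y * u) * Real.exp (-(u ^ 2) / 2)
      * Real.exp (-(w ^ α * u ^ α)))
  have h3 : ∫ v : ℝ, Real.cos (y * v) * Real.exp (-(v ^ 2) / 2) * Real.exp (-(|w * v| ^ α))
      = ∫ v : ℝ, Real.cos (y * |v|) * Real.exp (-(|v| ^ 2) / 2)
      * Real.exp (-(w ^ α * |v| ^ α)) := by
    refine integral_congr_ae (ae_of_all _ fun v => ?_)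
    simp only
    rw [sq_abs, abs_mul, abs_of_pos hw, Real.mul_rpow hw.le (abs_nonneg v)]
    congr 2
    rcases abs_cases v with h | h <;> rw [h.1]
    rw [mul_neg, Real.cos_neg]
  rw [h3, h2]
  field_simp

theorem hFun_eq {α : ℝ} (h0 : 0 < α) (y : ℝ) {w : ℝ} (hw : 0 < w) :
    hFun α y w = Real.pi⁻¹ * (α * ∫ u in Ioi (0:ℝ), Real.cos (y * u) * Real.exp (-(u ^ 2) / 2)
      * ((w ^ α * u ^ α) * Real.exp (-(w ^ α * u ^ α)))) := by
  have h := fourier_swap (m_int1 h0) y hw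
  have h1 : hFun α y w = ∫ z : ℝ, gauss (y - w * z) * ((2 * Real.pi)⁻¹ *
      ∫ u : ℝ, Real.cos (z * u) * (α * |u| ^ α * Real.exp (-(|u| ^ α)))) := by
    unfold hFun
    refine integral_congr_ae ?_
    have : ∀ᵐ z : ℝ, z ≠ 0 := by
      simp [ae_iff]
    filter_upwards [this] with z hz
    rw [Dop_eq h0 hz]
  rw [h1, h]
  have h2 := integral_comp_abs (f := fun u => Real.cos (y * u) * Real.exp (-(u ^ 2) / 2)
      * ((w ^ α * u ^ α) * Real.exp (-(w ^ α * u ^ α))))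
  have h3 : ∫ v : ℝ, Real.cos (y * v) * Real.exp (-(v ^ 2) / 2) *
        (α * |w * v| ^ α * Real.exp (-(|w * v| ^ α)))
      = ∫ v : ℝ, α * (Real.cos (y * |v|) * Real.exp (-(|v| ^ 2) / 2)
      * ((w ^ α * |v| ^ α) * Real.exp (-(w ^ α * |v| ^ α)))) := by
    refine integral_congr_ae (ae_of_all _ fun v => ?_)
    simp only
    have hc : Real.cos (y * |v|) = Real.cos (y * v) := by
      rcases abs_cases v with h | h <;> rw [h.1]
      rw [mul_neg, Real.cos_neg]
    rw [sq_abs, abs_mul, abs_of_pos hw, Real.mul_rpow hw.le (abs_nonneg v), hc]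
    ring
  rw [h3, integral_const_mul, h2, mul_inv]
  ring

theorem gauss_eq' (y : ℝ) :
    gauss y = Real.pi⁻¹ * ∫ u in Ioi (0:ℝ), Real.cos (y * u) * Real.exp (-(u ^ 2) / 2) := by
  rw [gauss_eq]
  have h2 := integral_comp_abs (f := fun u => Real.cos (y * u) * Real.exp (-(u ^ 2) / 2))
  have h3 : ∫ v : ℝ, Real.cos (y * v) * Real.exp (-(v ^ 2) / 2)
      = ∫ v : ℝ, Real.cos (y * |v|) * Real.exp (-(|v| ^ 2) / 2) := by
    refine integral_congr_ae (ae_of_all _ fun v => ?_)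
    simp only
    rw [sq_abs]
    congr 1
    rcases abs_cases v with h | h <;> rw [h.1]
    rw [mul_neg, Real.cos_neg]
  rw [h3, h2]
  field_simp

theorem cAlpha_eq {α : ℝ} (h0 : 0 < α) (h2 : α < 2) :
    cAlpha α = Real.pi⁻¹ * (Real.sin (Real.pi * α / 2) * Real.Gamma (1 + α)) := by
  have hpi := Real.pi_pos
  unfold cAlpha
  split_ifs with h
  · subst h
    rw [mul_one, Real.sin_pi_div_two, one_add_one_eq_two, Real.Gamma_two]; simp
  · have h1 : Real.Gamma (2 - α) = (1 - α) * Real.Gamma (1 - α) := by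
      have := Real.Gamma_add_one (s := 1 - α) (by intro hh; apply h; linarith)
      rw [← this]; congr 1; ring
    have h3 : Real.Gamma (1 + α) = α * Real.Gamma α := by
      rw [add_comm, Real.Gamma_add_one h0.ne']
    have h4 := Real.Gamma_mul_Gamma_one_sub α
    have h5 : Real.sin (Real.pi * α)
        = 2 * Real.sin (Real.pi * α / 2) * Real.cos (Real.pi * α / 2) := by
      rw [← Real.sin_two_mul]; congr 1; ring
    have hg2 := Real.Gamma_pos_of_pos (show 0 < 2 - α by linarith)
    have hs : 0 < Real.sin (Real.pi * α / 2) :=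
      Real.sin_pos_of_pos_of_lt_pi (by positivity) (by nlinarith)
    have hc : Real.cos (Real.pi * α / 2) ≠ 0 := by
      intro hc
      rw [Real.cos_eq_zero_iff] at hc
      obtain ⟨k, hk⟩ := hc
      have h6 : α = 2 * k + 1 := by
        field_simp at hk; linarith
      have h7 : (k : ℝ) < 1 := by linarith
      have h8 : (-1 : ℝ) < k := by linarith
      have h9 : k = 0 := by
        have a : k < 1 := by exact_mod_cast h7
        have b : -1 < k := by exact_mod_cast h8
        omega
      apply h; rw [h6, h9]; simp
    have hg1 : Real.Gamma (1 - α) ≠ 0 := by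
      intro hh; rw [hh, mul_zero] at h1; exact hg2.ne' h1
    have h1α : 1 - α ≠ 0 := by intro hh; apply h; linarith
    rw [h5] at h4
    rw [h1, h3]
    have h10 : Real.Gamma α = Real.pi / (2 * Real.sin (Real.pi * α / 2)
        * Real.cos (Real.pi * α / 2)) / Real.Gamma (1 - α) := by
      rw [← h4]; field_simp
    rw [h10]
    have := hs.ne'
    generalize Real.sin (Real.pi * α / 2) = S at *
    generalize Real.cos (Real.pi * α / 2) = T at *
    field_simp
    ring

theorem cAlpha_pos {α : ℝ} (h0 : 0 < α) (h2 : α < 2) : 0 < cAlpha α := by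
  have hpi := Real.pi_pos
  rw [cAlpha_eq h0 h2]
  have := Real.Gamma_pos_of_pos (show 0 < 1 + α by linarith)
  have hs : 0 < Real.sin (Real.pi * α / 2) :=
    Real.sin_pos_of_pos_of_lt_pi (by positivity) (by nlinarith)
  positivity

/-- The two-sided uniform estimate. -/
theorem core {α : ℝ} (h0 : 0 < α) (h2 : α < 2) :
    ∃ C > (0:ℝ), ∀ w > (0:ℝ), ∀ y : ℝ, 1 ≤ |y| →
      |fFun α y w - gauss y - cAlpha α * w ^ α * |y| ^ (-(1 + α))|
        ≤ C * (w ^ α * |y| ^ (-(1 + α)) * (|y| ^ (-(2:ℝ)) + w ^ α)) ∧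
      |hFun α y w + α * cAlpha α * w ^ α * |y| ^ (-(1 + α))|
        ≤ C * (w ^ α * |y| ^ (-(1 + α)) * (|y| ^ (-(2:ℝ)) + w ^ α)) := by
  have hpi := Real.pi_pos
  set C0 := (2 ^ (3 + α) * Real.Gamma (3 + α) + 2 ^ (1 + 2 * α) * Real.Gamma (1 + 2 * α)) with hC0
  have G3 := Real.Gamma_pos_of_pos (show 0 < 3 + α by linarith)
  have G1 := Real.Gamma_pos_of_pos (show 0 < 1 + 2 * α by linarith)
  have hC0p : 0 < C0 := by positivity
  refine ⟨Real.pi⁻¹ * (1 + α) * C0, by positivity, fun w hw y hy => ?_⟩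
  have hε : 0 < w ^ α := by positivity
  have hcos : ∀ u, Real.cos (y * u) = Real.cos (|y| * u) := by
    intro u
    rcases abs_cases y with h | h <;> rw [h.1]
    rw [neg_mul, Real.cos_neg]
  have r1 := real_main (α := α) (y := |y|) (ε := w ^ α) (κ := -1)
    (G := fun x => Complex.exp (-x) - 1) (g := fun x => Real.exp (-x) - 1) h0 h2 hy hε
    (by fun_prop) (by intro x; push_cast; rfl) (fun x hx => exp_b2 hx)
    (fun x hx => by push_cast; exact exp_b3 hx)
  have r2 := real_main (α := α) (y := |y|) (ε := w ^ α) (κ := 1)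
    (G := fun x => x * Complex.exp (-x)) (g := fun x => x * Real.exp (-x)) h0 h2 hy hε
    (by fun_prop) (by intro x; push_cast; rfl)
    (fun x hx => by
      rw [norm_mul]
      have := exp_b1 hx
      have := norm_nonneg x
      nlinarith)
    (fun x hx => by
      have e : x * Complex.exp (-x) - ((1:ℝ):ℂ) * x = x * (Complex.exp (-x) - 1) := by
        push_cast; ring
      rw [e, norm_mul, sq]
      have := exp_b2 hx
      gcongr)
  set P := w ^ α * |y| ^ (-(1 + α)) * (|y| ^ (-(2:ℝ)) + w ^ α) with hP
  have hP0 : 0 ≤ P := by positivity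
  rw [cAlpha_eq h0 h2]
  constructor
  · have i1 : IntegrableOn (fun u : ℝ => Real.cos (y * u) * Real.exp (-(u ^ 2) / 2)) (Ioi 0) := by
      refine (Integrable.mono' ((integrable_exp_neg_mul_sq (b := 1/2) (by norm_num)))
        (Continuous.aestronglyMeasurable (by fun_prop)) (ae_of_all _ fun u => ?_)).integrableOn
      rw [norm_mul, Real.norm_eq_abs, Real.norm_eq_abs, Real.abs_exp]
      have h1 := Real.abs_cos_le_one (y * u)
      have : Real.exp (-(u ^ 2) / 2) = Real.exp (-(1/2) * u ^ 2) := by congr 1; ring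
      rw [this]
      have := Real.exp_pos (-(1/2) * u ^ 2)
      nlinarith
    have i2 : IntegrableOn (fun u : ℝ => Real.cos (y * u) * Real.exp (-(u ^ 2) / 2)
        * Real.exp (-(w ^ α * u ^ α))) (Ioi 0) := by
      refine Integrable.mono i1 (AEStronglyMeasurable.mul i1.aestronglyMeasurable ?_) ?_
      · exact (Measurable.aestronglyMeasurable (by fun_prop))
      · filter_upwards [ae_restrict_mem measurableSet_Ioi] with u hu
        have hu0 : (0:ℝ) < u := hu
        rw [norm_mul]
        have : ‖Real.exp (-(w ^ α * u ^ α))‖ ≤ 1 := by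
          rw [Real.norm_eq_abs, Real.abs_exp, Real.exp_le_one_iff]
          have : 0 ≤ w ^ α * u ^ α := by positivity
          linarith
        have h9 := norm_nonneg (Real.cos (y * u) * Real.exp (-(u ^ 2) / 2))
        nlinarith
    have e : fFun α y w - gauss y = Real.pi⁻¹ * ∫ u in Ioi (0:ℝ),
        Real.cos (|y| * u) * Real.exp (-(u ^ 2) / 2) * (Real.exp (-(w ^ α * u ^ α)) - 1) := by
      rw [fFun_eq h0 y hw, gauss_eq', ← mul_sub, ← integral_sub i2 i1]
      congr 1
      refine integral_congr_ae (ae_of_all _ fun u => ?_)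
      simp only [hcos]; ring
    rw [e]
    set J := ∫ u in Ioi (0:ℝ),
        Real.cos (|y| * u) * Real.exp (-(u ^ 2) / 2) * (Real.exp (-(w ^ α * u ^ α)) - 1)
    set S := Real.sin (Real.pi * α / 2) * Real.Gamma (1 + α)
    have e2 : Real.pi⁻¹ * J - Real.pi⁻¹ * S * w ^ α * |y| ^ (-(1 + α))
        = Real.pi⁻¹ * (J + -1 * w ^ α * S * |y| ^ (-(1 + α))) := by ring
    rw [e2, abs_mul, abs_of_pos (inv_pos.2 hpi)]
    calc _ ≤ Real.pi⁻¹ * (C0 * P) := by gcongr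
      _ ≤ _ := by
        have : 0 ≤ Real.pi⁻¹ * C0 * P * α := by positivity
        nlinarith
  · have e : hFun α y w = Real.pi⁻¹ * (α * ∫ u in Ioi (0:ℝ),
        Real.cos (|y| * u) * Real.exp (-(u ^ 2) / 2)
          * ((w ^ α * u ^ α) * Real.exp (-(w ^ α * u ^ α)))) := by
      rw [hFun_eq h0 y hw]
      simp only [hcos]
    rw [e]
    set J := ∫ u in Ioi (0:ℝ),
        Real.cos (|y| * u) * Real.exp (-(u ^ 2) / 2)
          * ((w ^ α * u ^ α) * Real.exp (-(w ^ α * u ^ α)))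
    set S := Real.sin (Real.pi * α / 2) * Real.Gamma (1 + α)
    have e2 : Real.pi⁻¹ * (α * J) + α * (Real.pi⁻¹ * S) * w ^ α * |y| ^ (-(1 + α))
        = Real.pi⁻¹ * α * (J + 1 * w ^ α * S * |y| ^ (-(1 + α))) := by ring
    rw [e2, abs_mul, abs_of_pos (by positivity)]
    calc _ ≤ Real.pi⁻¹ * α * (C0 * P) := by gcongr
      _ ≤ _ := by
        have : 0 ≤ Real.pi⁻¹ * C0 * P := by positivity
        nlinarith

theorem psi_compare {α : ℝ} (hα : α ∈ Set.Ioo (0 : ℝ) 2) {ψ : ℝ → ℕ → ℝ → ℝ}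
    (hψ : IsPsiFamily ψ) :
    ∃ K > (0:ℝ), ∀ y : ℝ, 1 ≤ |y| →
      |y| ^ (-(1 + α)) ≤ K * ψ α 0 y ∧ ψ α 0 y ≤ K * |y| ^ (-(1 + α)) ∧
      |(|y| ^ (-(1 + α)) - ψ α 0 y)| ≤ K * ψ α 0 y * (1 / Real.sqrt |y|) := by
  obtain ⟨h0, h2⟩ := hα
  obtain ⟨c, hc, C, hcC⟩ := hψ.unifBound {α} (by simpa using ⟨h0, h2⟩) isCompact_singleton 0
  have h3 : (0:ℝ) < 3 ^ (1 + α) := by positivity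
  refine ⟨2 * (2 + 1 / c) + |C| * 3 ^ (1 + α), by positivity, fun y hy => ?_⟩
  have hy0 : 0 < |y| := by linarith
  have hpos := hψ.pos α ⟨h0, h2⟩ 0 y
  set p := |y| ^ (-(1 + α)) with hp
  have hp0 : 0 < p := by positivity
  have hA : 0 ≤ |C| * 3 ^ (1 + α) := by positivity
  have hB : 0 < 1 / c := by positivity
  rcases le_total 3 |y| with h | h
  · have e : ψ α 0 y = p := by
      rw [hψ.eq_tail α ⟨h0, h2⟩ 0 y h, pow_zero, hp, Real.rpow_neg hy0.le, one_div, add_comm]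
    rw [e]
    refine ⟨by nlinarith, by nlinarith, ?_⟩
    rw [sub_self, abs_zero]; positivity
  · obtain ⟨b1, b2⟩ := hcC α rfl y hy h
    have hp1 : p ≤ 1 := Real.rpow_le_one_of_one_le_of_nonpos hy (by linarith)
    have hp3 : (3 ^ (1 + α))⁻¹ ≤ p := by
      rw [← Real.rpow_neg (by norm_num)]
      exact Real.rpow_le_rpow_of_nonpos hy0 h (by linarith)
    have hk : 1 ≤ 1 / c * ψ α 0 y := by
      rw [one_div, ← div_eq_inv_mul, one_le_div hc]; exact b1
    have hC : ψ α 0 y ≤ |C| := b2.trans (le_abs_self C)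
    have hCp : |C| ≤ |C| * 3 ^ (1 + α) * p := by
      have : 1 ≤ 3 ^ (1 + α) * p := by
        rw [inv_le_iff_one_le_mul₀ h3] at hp3; linarith
      have := abs_nonneg C
      nlinarith
    refine ⟨by nlinarith, ?_, ?_⟩
    · have : 0 ≤ 2 * (2 + 1 / c) * p := by positivity
      nlinarith
    · have hs : 1 / 2 ≤ 1 / Real.sqrt |y| := by
        apply one_div_le_one_div_of_le (Real.sqrt_pos.2 hy0)
        rw [Real.sqrt_le_left (by norm_num)]; linarith
      have h5 : |p - ψ α 0 y| ≤ (2 + 1 / c) * ψ α 0 y := by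
        rw [abs_le]; constructor <;> nlinarith
      calc _ ≤ (2 + 1 / c) * ψ α 0 y := h5
        _ ≤ (2 * (2 + 1 / c) + |C| * 3 ^ (1 + α)) * ψ α 0 y * (1 / 2) := by nlinarith
        _ ≤ _ := by gcongr

theorem wn_pow {σ δ α : ℝ} (hσ : 0 < σ) (hδ : 0 < δ) (h0 : 0 < α) {n : ℕ} (hn : 0 < n) :
    0 < wn n σ δ α ∧ wn n σ δ α ^ α = (δ / σ) ^ α * (1 / (n:ℝ) ^ (1 - α / 2)) := by
  have hn' : (0:ℝ) < n := by exact_mod_cast hn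
  unfold wn
  refine ⟨by positivity, ?_⟩
  rw [mul_div_assoc, Real.mul_rpow (by positivity) (by positivity), ← Real.rpow_mul hn'.le, mul_comm,
    one_div ((n:ℝ) ^ (1 - α / 2)), ← Real.rpow_neg hn'.le]
  congr 2
  field_simp
  ring

theorem main_arith {a c C1 K Kq : ℝ} (ha : 0 ≤ a) (hc : 0 < c) (hC1 : 0 < C1) (hK : 0 < K)
    (hKq : 0 < Kq) {ε p P g q r X : ℝ} (hp : 0 ≤ p) (hP : 0 < P) (hε : ε = Kq * q) (hq : 0 < q)
    (hr : r ≤ g) (hpP : p ≤ K * P) (hd : |p - P| ≤ K * P * g) (hr0 : 0 ≤ r)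
    (hX : |X + a * c * ε * p| ≤ C1 * (ε * p * (r + ε))) :
    |X + a * c * ε * P| ≤ (C1 * K * (1 + Kq) + a * c * K) * (ε * P) * (g + q) := by
  have hε0 : 0 < ε := by rw [hε]; positivity
  have hg : 0 ≤ g := hr0.trans hr
  have e : X + a * c * ε * P = (X + a * c * ε * p) + (- (a * c * ε)) * (p - P) := by ring
  rw [e]
  refine (abs_add_le _ _).trans ?_
  rw [abs_mul, abs_neg, abs_of_nonneg (by positivity : 0 ≤ a * c * ε)]
  have t1 : C1 * (ε * p * (r + ε)) ≤ C1 * (ε * (K * P) * ((1 + Kq) * (g + q))) := by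
    gcongr
    rw [hε]
    nlinarith [mul_nonneg hKq.le hg]
  have t2 : a * c * ε * |p - P| ≤ a * c * ε * (K * P * (g + q)) := by
    gcongr
    refine hd.trans ?_
    gcongr
    linarith
  linarith

theorem low_arith {c C1 K gY : ℝ} (hc : 0 < c) (hC1 : 0 < C1) (hK : 0 < K)
    (hgY : 0 < gY) {ε p P r f ph : ℝ} (hp : 0 ≤ p) (hp1 : p ≤ 1) (hε : 0 < ε)
    (hPp : P ≤ K * p) (hph : 0 < ph) (hr0 : 0 ≤ r) (hr1 : r ≤ 1)
    (he1 : ε ≤ 1) (he2 : ε ≤ c / (4 * C1)) (he3 : ε ≤ gY / (4 * C1))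
    (hcase : r ≤ c / (4 * C1) ∨ gY ≤ ph)
    (hX : |f - ph - c * ε * p| ≤ C1 * (ε * p * (r + ε))) :
    ε * P ≤ (2 * K / c + 2 * K / gY) * f ∧ 0 ≤ f := by
  have hlow := (abs_le.1 hX).1
  rw [le_div_iff₀ (by positivity)] at he2 he3
  rcases hcase with h | h
  · rw [le_div_iff₀ (by positivity)] at h
    have hεp : 0 ≤ ε * p := by positivity
    have h1 : C1 * (ε * p * (r + ε)) ≤ ε * p * (c / 2) := by
      have : C1 * (r + ε) ≤ c / 2 := by nlinarith
      nlinarith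
    have hf : c / 2 * (ε * p) ≤ f := by nlinarith
    have hf0 : 0 ≤ f := le_trans (by positivity) hf
    refine ⟨?_, hf0⟩
    have h2 : ε * P ≤ 2 * K / c * f := by
      calc ε * P ≤ ε * (K * p) := by gcongr
        _ = 2 * K / c * (c / 2 * (ε * p)) := by field_simp
        _ ≤ _ := by gcongr
    have : 0 ≤ 2 * K / gY * f := by positivity
    linarith
  · have h1 : C1 * (ε * p * (r + ε)) ≤ gY / 2 := by
      have : ε * p * (r + ε) ≤ ε * 1 * (1 + 1) := by gcongr
      nlinarith
    have : 0 ≤ c * ε * p := by positivity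
    have hf : gY / 2 ≤ f := by linarith
    have hf0 : 0 ≤ f := le_trans (by positivity) hf
    refine ⟨?_, hf0⟩
    have h2 : ε * P ≤ 2 * K / gY * f := by
      calc ε * P ≤ 1 * (K * 1) := by
            have : ε * P ≤ ε * (K * p) := by gcongr
            refine this.trans ?_
            gcongr
        _ = 2 * K / gY * (gY / 2) := by field_simp
        _ ≤ _ := by gcongr
    have : 0 ≤ 2 * K / c * f := by positivity
    linarith

/-- sharp approximation of `f_α` and `h_α` for `|y| > Γ`. -/
theorem statement9 (σ δ α : ℝ) (hσ : 0 < σ) (hδ : 0 < δ) (hα : α ∈ Set.Ioo (0 : ℝ) 2)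
    (ψ : ℝ → ℕ → ℝ → ℝ) (hψ : IsPsiFamily ψ) :
    ∃ C > (0 : ℝ), ∃ N : ℕ, ∀ n ≥ N, ∀ Γ : ℝ, 1 ≤ Γ → ∀ y : ℝ, Γ < |y| →
      |fFun α y (wn n σ δ α) - gauss y - cAlpha α * wn n σ δ α ^ α * ψ α 0 y| ≤
        C * fFun α y (wn n σ δ α) * (1 / Real.sqrt Γ + 1 / (n : ℝ) ^ (1 - α / 2)) ∧
      |hFun α y (wn n σ δ α) + α * cAlpha α * wn n σ δ α ^ α * ψ α 0 y| ≤
        C * wn n σ δ α ^ α * ψ α 0 y * (1 / Real.sqrt Γ + 1 / (n : ℝ) ^ (1 - α / 2)) := by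
  obtain ⟨h0, h2⟩ := hα
  obtain ⟨C1, hC1, hcore⟩ := core h0 h2
  obtain ⟨K, hK, hcmp⟩ := psi_compare ⟨h0, h2⟩ hψ
  have hc := cAlpha_pos h0 h2
  set c := cAlpha α with hcdef
  set Kq := (δ / σ) ^ α with hKq
  have hKq0 : 0 < Kq := by positivity
  set Y := Real.sqrt (4 * C1 / c) with hY
  have hY2 : Y ^ 2 = 4 * C1 / c := Real.sq_sqrt (by positivity)
  have hgY := gauss_pos Y
  set gY := gauss Y with hgYdef
  set C6 := 2 * K / c + 2 * K / gY with hC6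
  have hC60 : 0 < C6 := by positivity
  set B1 := C1 * K * (1 + Kq) + 1 * c * K with hB1
  set B2 := C1 * K * (1 + Kq) + α * c * K with hB2
  have hB10 : 0 < B1 := by positivity
  have hB20 : 0 < B2 := by positivity
  have hq : Tendsto (fun n : ℕ => Kq * (1 / (n:ℝ) ^ (1 - α / 2))) atTop (𝓝 0) := by
    have := (tendsto_rpow_neg_atTop (show 0 < 1 - α / 2 by linarith)).comp
      (tendsto_natCast_atTop_atTop (R := ℝ))
    have h3 := this.const_mul Kq
    rw [mul_zero] at h3
    refine h3.congr fun n => ?_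
    simp only [Function.comp]
    rw [Real.rpow_neg (Nat.cast_nonneg n), one_div]
  have hm : 0 < min 1 (min (c / (4 * C1)) (gY / (4 * C1))) := by positivity
  have hev : ∀ᶠ n : ℕ in atTop, 0 < n ∧ Kq * (1 / (n:ℝ) ^ (1 - α / 2))
      < min 1 (min (c / (4 * C1)) (gY / (4 * C1))) :=
    (eventually_gt_atTop 0).and (hq.eventually (gt_mem_nhds hm))
  obtain ⟨N, hN⟩ := eventually_atTop.1 hev
  refine ⟨C6 * B1 + B2, by positivity, N, fun n hn Γ hΓ y hy => ?_⟩
  obtain ⟨hn0, hnlt⟩ := hN n hn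
  obtain ⟨hw, hwe⟩ := wn_pow hσ hδ h0 hn0
  set w := wn n σ δ α with hwdef
  have hn' : (0:ℝ) < n := by exact_mod_cast hn0
  set q := 1 / (n:ℝ) ^ (1 - α / 2) with hqdef
  have hq0 : 0 < q := by positivity
  have hy1 : 1 ≤ |y| := by linarith
  have hy0 : 0 < |y| := by linarith
  obtain ⟨k1, k2⟩ := hcore w hw y hy1
  obtain ⟨m1, m2, m3⟩ := hcmp y hy1
  have hP := hψ.pos α ⟨h0, h2⟩ 0 y
  set P := ψ α 0 y with hPdef
  set p := |y| ^ (-(1 + α)) with hpdef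
  have hp0 : 0 < p := by positivity
  have hp1 : p ≤ 1 := Real.rpow_le_one_of_one_le_of_nonpos hy1 (by linarith)
  set r := |y| ^ (-(2:ℝ)) with hrdef
  have hr0 : 0 < r := by positivity
  have hr1 : r ≤ 1 := Real.rpow_le_one_of_one_le_of_nonpos hy1 (by norm_num)
  set ε := w ^ α with hε
  have hε0 : 0 < ε := by positivity
  set g := 1 / Real.sqrt Γ with hg
  have hsg : 1 / Real.sqrt |y| ≤ g :=
    one_div_le_one_div_of_le (Real.sqrt_pos.2 (by linarith)) (Real.sqrt_le_sqrt hy.le)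
  have hg0 : 0 < g := by
    have : 0 < Real.sqrt Γ := Real.sqrt_pos.2 (by linarith)
    positivity
  have hrs : r ≤ 1 / Real.sqrt |y| := by
    rw [Real.sqrt_eq_rpow, one_div, ← Real.rpow_neg hy0.le]
    exact Real.rpow_le_rpow_of_exponent_le hy1 (by norm_num)
  have m3' : |p - P| ≤ K * P * g := m3.trans (by gcongr)
  rw [← hwe] at hnlt
  have hl1 := hnlt.le.trans (min_le_left _ _)
  have hl2 := hnlt.le.trans ((min_le_right _ _).trans (min_le_left _ _))
  have hl3 := hnlt.le.trans ((min_le_right _ _).trans (min_le_right _ _))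
  have hcase : r ≤ c / (4 * C1) ∨ gY ≤ gauss y := by
    rcases le_total Y |y| with h | h
    · left
      have h5 : Y ^ 2 ≤ |y| ^ 2 := by
        have : 0 ≤ Y := Real.sqrt_nonneg _
        gcongr
      have h6 : r = (|y| ^ 2)⁻¹ := by
        rw [hrdef, Real.rpow_neg hy0.le, Real.rpow_two]
      rw [h6, inv_le_comm₀ (by positivity) (by positivity), inv_div, ← hY2]
      exact h5
    · right
      rw [hgYdef]
      unfold gauss
      have h7 : y ^ 2 ≤ Y ^ 2 := by
        rw [← sq_abs y]; gcongr
      gcongr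
  obtain ⟨l1, l2⟩ := low_arith hc hC1 hK hgY hp0.le hp1 hε0 m2 (gauss_pos y) hr0.le hr1
    hl1 hl2 hl3 hcase k1
  constructor
  · have := main_arith (a := 1) (X := -(fFun α y w - gauss y)) zero_le_one hc hC1 hK hKq0 hp0.le hP
      hwe hq0 (hrs.trans hsg) m1 m3' hr0.le (by
        rw [← abs_neg]
        refine le_trans (le_of_eq ?_) k1
        congr 1; ring)
    rw [← abs_neg] at this
    have e : -(-(fFun α y w - gauss y) + 1 * c * ε * P) = fFun α y w - gauss y - c * ε * P := by
      ring
    rw [e] at this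
    refine this.trans ?_
    have t : B1 * (ε * P) ≤ (C6 * B1 + B2) * fFun α y w := by
      have t1 : B1 * (ε * P) ≤ B1 * (C6 * fFun α y w) := by gcongr
      have t2 : 0 ≤ B2 * fFun α y w := by positivity
      linarith
    gcongr
  · have := main_arith (a := α) (X := hFun α y w) h0.le hc hC1 hK hKq0 hp0.le hP
      hwe hq0 (hrs.trans hsg) m1 m3' hr0.le k2
    refine this.trans ?_
    have e : (C6 * B1 + B2) * ε * P = (C6 * B1 + B2) * (ε * P) := by ring
    rw [e]
    have t : B2 * (ε * P) ≤ (C6 * B1 + B2) * (ε * P) := by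
      have t0 : 0 ≤ C6 * B1 := by positivity
      have t1 : 0 ≤ ε * P := by positivity
      exact mul_le_mul_of_nonneg_right (le_add_of_nonneg_left t0) t1
    exact mul_le_mul_of_nonneg_right t (by positivity)

end LevyLAN
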